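/- arXiv:1609.02252 — 9 statements merged into one kernel-verified Lean document; each statement's English description precedes it below -/
import Mathlib

section
/- Let n ≥ 3 and B ≥ 1 be integers, let p ∈ (0,1] and x ∈ (0,1] be real numbers, and write C_k = C(n−3+k, k). Define π(i) = C_i·x^i / (∑_{k=0}^{B} C_k·x^k) for 0 ≤ i ≤ B. Then ∑_{i=0}^{B} π(i) = 1 and π(i)·(p·x) = π(i+1)·(p·(i+1)/(n−2+i)) for every 0 ≤ i ≤ B−1. (Thus π is the stationary distribution of the birth–death chain on {0,…,B} with birth rates p_{i,i+1} = p·x and death rates p_{i,i−1} = p·i/(n−3+i).) -/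
/-- Stationary distribution of the relay-buffer birth–death chain on `{0,…,B}`
with birth rates `p·x` and death rates `p·i/(n−3+i)`: normalization and detailed balance. -/
theorem stmt2 (n B : ℕ) (hn : 3 ≤ n) (hB : 1 ≤ B)
    (p x : ℝ) (hp0 : 0 < p) (hp1 : p ≤ 1) (hx0 : 0 < x) (hx1 : x ≤ 1)
    (pr : ℕ → ℝ)
    (hpr : ∀ i ≤ B, pr i = ((n - 3 + i).choose i : ℝ) * x ^ i /
      (∑ k ∈ Finset.range (B + 1), ((n - 3 + k).choose k : ℝ) * x ^ k)) :
    (∑ i ∈ Finset.range (B + 1), pr i = 1) ∧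
    (∀ i < B, pr i * (p * x)
      = pr (i + 1) * (p * ((i : ℝ) + 1) / ((n : ℝ) - 2 + (i : ℝ)))) := by
  obtain ⟨m, rfl⟩ := Nat.exists_eq_add_of_le' hn
  simp only [Nat.add_sub_cancel] at hpr
  have hS : 0 < ∑ k ∈ Finset.range (B + 1), ((m + k).choose k : ℝ) * x ^ k :=
    Finset.sum_pos (fun k _ => mul_pos (mod_cast Nat.choose_pos (Nat.le_add_left k m))
      (pow_pos hx0 k)) ⟨0, by simp⟩
  refine ⟨?_, fun i hi => ?_⟩
  · rw [Finset.sum_congr rfl fun i hi => hpr i (Nat.lt_succ_iff.mp (Finset.mem_range.mp hi)),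
      ← Finset.sum_div, div_self hS.ne']
  · have hC : ((m : ℝ) + i + 1) * ((m + i).choose i : ℝ)
        = ((m + (i + 1)).choose (i + 1) : ℝ) * ((i : ℝ) + 1) :=
      mod_cast Nat.add_one_mul_choose_eq (m + i) i
    have hd : ((m + 3 : ℕ) : ℝ) - 2 + i = (m : ℝ) + i + 1 := by push_cast; ring
    have hd0 : (m : ℝ) + i + 1 ≠ 0 := by positivity
    rw [hpr i hi.le, hpr (i + 1) hi, hd, div_mul_div_comm, div_mul_eq_mul_div,
      div_eq_div_iff hS.ne' (mul_ne_zero hS.ne' hd0)]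
    linear_combination (x ^ (i + 1) * p *
      ∑ k ∈ Finset.range (B + 1), ((m + k).choose k : ℝ) * x ^ k) * hC
end

section
/- Let n ≥ 3, B_s ≥ 1, B_r ≥ 1 be integers and let p_sd ≥ 0, p_sr ≥ 0 be reals with 0 < p_sd + p_sr < 1; set μ = p_sd + p_sr and C_k = C(n−3+k, k). For λ ∈ (0,1) with λ ≠ μ define τ(λ) = λ(1−μ)/(μ(1−λ)), π_s0(λ) = (μ−λ)/(μ − λ·τ(λ)^{B_s}), x(λ) = 1 − π_s0(λ), π_rB(λ) = C_{B_r}·x(λ)^{B_r}/∑_{k=0}^{B_r} C_k·x(λ)^k, and T(λ) = p_sd·(1−π_s0(λ)) + p_sr·(1−π_s0(λ))·(1−π_rB(λ)). Then lim_{λ→1⁻} T(λ) = p_sd + p_sr·B_r/(n−2+B_r). -/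
open Filter Topology in
/-- A quotient whose numerator converges and whose denominator is `a - b * c ^ N`, with `a`
convergent, `b` tending to a positive limit and `c` tending to infinity, vanishes in the limit. -/
theorem tendsto_div_sub_mul_pow_zero {α : Type*} {l : Filter α} {u a b c : α → ℝ}
    {u₀ a₀ b₀ : ℝ} {N : ℕ} (hN : N ≠ 0) (hu : Tendsto u l (𝓝 u₀)) (ha : Tendsto a l (𝓝 a₀))
    (hb : Tendsto b l (𝓝 b₀)) (hb₀ : 0 < b₀) (hc : Tendsto c l atTop) :
    Tendsto (fun t => u t / (a t - b t * c t ^ N)) l (𝓝 0) := by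
  have hbc : Tendsto (fun t => b t * c t ^ N) l atTop :=
    hb.pos_mul_atTop hb₀ ((tendsto_pow_atTop hN).comp hc)
  have hden : Tendsto (fun t => a t - b t * c t ^ N) l atBot := by
    simpa only [sub_eq_add_neg, Function.comp_apply] using ha.add_atBot (tendsto_neg_atTop_atBot.comp hbc)
  exact hu.div_atBot hden

open Filter Topology in
theorem tendsto_mul_div_one_sub_atTop {mu : ℝ} (h0 : 0 < mu) (h1 : mu < 1) :
    Tendsto (fun lam : ℝ => lam * (1 - mu) / (mu * (1 - lam))) (𝓝[<] 1) atTop := by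
  have hnum : Tendsto (fun lam : ℝ => lam * (1 - mu)) (𝓝[<] 1) (𝓝 (1 - mu)) := by
    have h : Continuous fun lam : ℝ => lam * (1 - mu) := by fun_prop
    simpa using (h.tendsto 1).mono_left nhdsWithin_le_nhds
  have hden : Tendsto (fun lam : ℝ => mu * (1 - lam)) (𝓝[<] 1) (𝓝[>] 0) := by
    refine tendsto_nhdsWithin_iff.2 ⟨?_, ?_⟩
    · have h : Continuous fun lam : ℝ => mu * (1 - lam) := by fun_prop
      simpa using (h.tendsto 1).mono_left nhdsWithin_le_nhds
    · filter_upwards [self_mem_nhdsWithin] with lam hlam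
      exact mul_pos h0 (sub_pos.2 hlam)
  simpa only [div_eq_mul_inv, Function.comp_apply] using
    hnum.pos_mul_atTop (sub_pos.2 h1) (tendsto_inv_nhdsGT_zero.comp hden)

theorem sum_range_choose_add_mul (m r : ℕ) :
    (∑ k ∈ Finset.range (r + 1), (m + k).choose k) * (m + 1) =
      (m + r + 1) * (m + r).choose r := by
  induction r with
  | zero => simp
  | succ r ih =>
    have h := Nat.add_one_mul_choose_eq (m + r) r
    rw [Finset.sum_range_succ, add_mul, ih, h, ← add_assoc]
    ring

theorem choose_div_sum_range_choose (m r : ℕ) :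
    ((m + r).choose r : ℝ) / ∑ k ∈ Finset.range (r + 1), ((m + k).choose k : ℝ) =
      (m + 1) / (m + r + 1) := by
  have hsum : 0 < ∑ k ∈ Finset.range (r + 1), ((m + k).choose k : ℝ) :=
    Finset.sum_pos (fun k _ => by exact_mod_cast Nat.choose_pos (Nat.le_add_left k m))
      ⟨0, by simp⟩
  rw [div_eq_div_iff hsum.ne' (by positivity)]
  have h : (∑ k ∈ Finset.range (r + 1), ((m + k).choose k : ℝ)) * (m + 1) =
      (m + r + 1) * ((m + r).choose r : ℝ) := by
    exact_mod_cast sum_range_choose_add_mul m r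
  linarith


/-- Theorem 2 (throughput capacity): as the packet generating rate `lam → 1⁻`,
the per-flow throughput `T(λ)` tends to `p_sd + p_sr·B_r/(n−2+B_r)`. -/
theorem stmt5 (n Bs Br : ℕ) (hn : 3 ≤ n) (hBs : 1 ≤ Bs) (hBr : 1 ≤ Br)
    (psd psr : ℝ) (hpsd : 0 ≤ psd) (hpsr : 0 ≤ psr)
    (hmu0 : 0 < psd + psr) (hmu1 : psd + psr < 1) :
    Filter.Tendsto
      (fun lam : ℝ =>
        let mu : ℝ := psd + psr
        let tau : ℝ := lam * (1 - mu) / (mu * (1 - lam))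
        let pis0 : ℝ := (mu - lam) / (mu - lam * tau ^ Bs)
        let x : ℝ := 1 - pis0
        let pirB : ℝ := ((n - 3 + Br).choose Br : ℝ) * x ^ Br /
          (∑ k ∈ Finset.range (Br + 1), ((n - 3 + k).choose k : ℝ) * x ^ k)
        psd * (1 - pis0) + psr * (1 - pis0) * (1 - pirB))
      (nhdsWithin 1 (Set.Ioo (0 : ℝ) 1))
      (nhds (psd + psr * (Br : ℝ) / ((n : ℝ) - 2 + (Br : ℝ)))) := by
  have hpi : Filter.Tendsto
      (fun lam : ℝ => (psd + psr - lam) / (psd + psr - lam *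
        (lam * (1 - (psd + psr)) / ((psd + psr) * (1 - lam))) ^ Bs))
      (nhdsWithin 1 (Set.Ioo (0 : ℝ) 1)) (nhds 0) := by
    have hid : Filter.Tendsto (fun lam : ℝ => lam) (nhdsWithin 1 (Set.Ioo (0 : ℝ) 1)) (nhds 1) :=
      nhdsWithin_le_nhds
    exact tendsto_div_sub_mul_pow_zero (by omega) (hid.const_sub _) tendsto_const_nhds hid one_pos
      ((tendsto_mul_div_one_sub_atTop hmu0 hmu1).mono_left
        (nhdsWithin_mono 1 Set.Ioo_subset_Iio_self))
  have hx := hpi.const_sub 1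
  rw [sub_zero] at hx
  obtain ⟨m, rfl⟩ := Nat.exists_eq_add_of_le' hn
  have hsum : (∑ k ∈ Finset.range (Br + 1), ((m + 3 - 3 + k).choose k : ℝ) * 1 ^ k) ≠ 0 := by
    refine (Finset.sum_pos (fun k _ => ?_) ⟨0, by simp⟩).ne'
    rw [one_pow, mul_one]
    exact_mod_cast Nat.choose_pos (Nat.le_add_left k _)
  have hB := ((hx.pow Br).const_mul ((m + 3 - 3 + Br).choose Br : ℝ)).div
    (tendsto_finsetSum (Finset.range (Br + 1)) fun k _ =>
      (hx.pow k).const_mul ((m + 3 - 3 + k).choose k : ℝ)) hsum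
  have hT := (hx.const_mul psd).add ((hx.const_mul psr).mul (hB.const_sub 1))
  simp only [one_pow, mul_one, Nat.add_sub_cancel, choose_div_sum_range_choose] at hT ⊢
  have hlim : psd + psr * (Br : ℝ) / (((m + 3 : ℕ) : ℝ) - 2 + Br) =
      psd + psr * (1 - (m + 1) / (m + Br + 1)) := by
    have h : (m : ℝ) + Br + 1 ≠ 0 := by positivity
    have h' : ((m + 3 : ℕ) : ℝ) - 2 + Br = m + Br + 1 := by push_cast; ring
    rw [h']
    field_simp
    ring
  rw [hlim]
  exact hT
end

section
/- Let λ ∈ (0,1) be fixed and let B ≥ 1 be an integer. For μ ∈ (0,1) with μ ≠ λ set τ(μ) = λ(1−μ)/(μ(1−λ)) and f(μ) = (μ−λ)/(μ − λ·τ(μ)^B). Then f is strictly increasing: for all μ₁, μ₂ ∈ (0,1) with μ₁ < μ₂, μ₁ ≠ λ and μ₂ ≠ λ, one has f(μ₁) < f(μ₂). -/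
/-- Cancelling the factor `μ - λ` expresses the empty-buffer probability through a geometric sum. -/
lemma emptyProb_eq_inv_geom_sum {l m : ℝ} (hl : l < 1) (hm : m ≠ 0) (hne : m ≠ l) (B : ℕ) :
    (m - l) / (m - l * (l * (1 - m) / (m * (1 - l))) ^ B)
      = (1 + l / (m * (1 - l)) *
          ∑ i ∈ Finset.range B, (l * (1 - m) / (m * (1 - l))) ^ i)⁻¹ := by
  have h1 : 1 - l ≠ 0 := (sub_pos.2 hl).ne'
  have h2 : m - l ≠ 0 := sub_ne_zero.2 hne
  have ht : 1 - l * (1 - m) / (m * (1 - l)) = (m - l) / (m * (1 - l)) := by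
    field_simp
    ring
  have hg := mul_neg_geom_sum (l * (1 - m) / (m * (1 - l))) B
  rw [ht] at hg
  have hd : m - l * (l * (1 - m) / (m * (1 - l))) ^ B
      = (m - l) * (1 + l / (m * (1 - l)) *
          ∑ i ∈ Finset.range B, (l * (1 - m) / (m * (1 - l))) ^ i) := by
    linear_combination -l * hg
  rw [hd, div_mul_cancel_left₀ h2]

/-- The empty-source-buffer probability `π_s(0) = (μ−λ)/(μ − λ·τ(μ)^B)` is strictly
increasing in the service rate `μ` (first half of the proof of Corollary 2). -/
theorem stmt6 (lam : ℝ) (hlam : lam ∈ Set.Ioo (0 : ℝ) 1) (B : ℕ) (hB : 1 ≤ B) :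
    ∀ mu1 mu2 : ℝ, mu1 ∈ Set.Ioo (0 : ℝ) 1 → mu2 ∈ Set.Ioo (0 : ℝ) 1 →
      mu1 < mu2 → mu1 ≠ lam → mu2 ≠ lam →
      (mu1 - lam) / (mu1 - lam * (lam * (1 - mu1) / (mu1 * (1 - lam))) ^ B)
        < (mu2 - lam) / (mu2 - lam * (lam * (1 - mu2) / (mu2 * (1 - lam))) ^ B) := by
  obtain ⟨hl0, hl1⟩ := hlam
  rintro a b ⟨ha0, ha1⟩ ⟨hb0, hb1⟩ hab ha hb
  rw [emptyProb_eq_inv_geom_sum hl1 ha0.ne' ha, emptyProb_eq_inv_geom_sum hl1 hb0.ne' hb]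
  have hl : 0 < 1 - lam := sub_pos.2 hl1
  have hb' : 0 < 1 - b := sub_pos.2 hb1
  have hτ : 0 < lam * (1 - b) / (b * (1 - lam)) := by positivity
  have hS : 0 < ∑ i ∈ Finset.range B, (lam * (1 - b) / (b * (1 - lam))) ^ i :=
    Finset.sum_pos (fun i _ => pow_pos hτ i) (Finset.nonempty_range_iff.2 (by omega))
  have hττ : lam * (1 - b) / (b * (1 - lam)) ≤ lam * (1 - a) / (a * (1 - lam)) := by
    have : 0 < 1 - a := sub_pos.2 ha1
    gcongr
  have hSS : ∑ i ∈ Finset.range B, (lam * (1 - b) / (b * (1 - lam))) ^ i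
      ≤ ∑ i ∈ Finset.range B, (lam * (1 - a) / (a * (1 - lam))) ^ i :=
    Finset.sum_le_sum fun i _ => pow_le_pow_left₀ hτ.le hττ i
  have hc : lam / (b * (1 - lam)) < lam / (a * (1 - lam)) := by gcongr
  have hc0 : 0 < lam / (b * (1 - lam)) := by positivity
  exact inv_strictAnti₀ (add_pos one_pos (mul_pos hc0 hS))
    (add_lt_add_right (mul_lt_mul hc hSS hS (hc0.trans hc).le) 1)
end

section
/- Let n ≥ 3 and B ≥ 1 be integers and write C_k = C(n−3+k, k). Then the function x ↦ x·(1 − C_B·x^B/∑_{k=0}^{B} C_k·x^k) is strictly increasing on (0, ∞). -/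
/-- The `2 × 2` minors of `(x ^ k, y ^ k)` are nonnegative for `0 ≤ x ≤ y`. -/
theorem pow_mul_pow_le_pow_mul_pow_of_le {x y : ℝ} (hx : 0 ≤ x) (hxy : x ≤ y) {j k : ℕ}
    (hjk : j ≤ k) : x ^ k * y ^ j ≤ y ^ k * x ^ j := by
  obtain ⟨d, rfl⟩ := Nat.exists_eq_add_of_le hjk
  have hy : 0 ≤ y := hx.trans hxy
  have h : x ^ j * y ^ j * x ^ d ≤ x ^ j * y ^ j * y ^ d := by gcongr
  calc x ^ (j + d) * y ^ j = x ^ j * y ^ j * x ^ d := by ring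
    _ ≤ x ^ j * y ^ j * y ^ d := h
    _ = y ^ (j + d) * x ^ j := by ring

/-- If the coefficient ratios `a k / b k` are nondecreasing (in cross-multiplied form), and
strictly increase from `k = 0` to `k = 1`, then the quotient of the polynomials with coefficients
`a` and `b` is strictly increasing (in cross-multiplied form). -/
theorem sum_mul_pow_mul_sum_lt_of_ratio_mono (a b : ℕ → ℝ) {N : ℕ} (hN : 2 ≤ N)
    (hab : ∀ j k, j ≤ k → a j * b k ≤ a k * b j) (hab' : a 0 * b 1 < a 1 * b 0)
    {x y : ℝ} (hx : 0 ≤ x) (hxy : x < y) :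
    (∑ k ∈ Finset.range N, a k * x ^ k) * (∑ k ∈ Finset.range N, b k * y ^ k) <
      (∑ k ∈ Finset.range N, a k * y ^ k) * (∑ k ∈ Finset.range N, b k * x ^ k) := by
  set t : ℕ → ℕ → ℝ := fun k j =>
    (a k * b j - a j * b k) * (y ^ k * x ^ j - x ^ k * y ^ j) with ht
  have ht0 : ∀ k j, 0 ≤ t k j := by
    intro k j
    rcases le_total j k with h | h
    · exact mul_nonneg (sub_nonneg.2 (hab j k h))
        (sub_nonneg.2 (pow_mul_pow_le_pow_mul_pow_of_le hx hxy.le h))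
    · have h1 := pow_mul_pow_le_pow_mul_pow_of_le hx hxy.le h
      exact mul_nonneg_of_nonpos_of_nonpos (sub_nonpos.2 (hab k j h)) (by linarith)
  have ht1 : 0 < t 1 0 := by
    simp only [ht, pow_one, pow_zero, mul_one]
    exact mul_pos (sub_pos.2 hab') (sub_pos.2 hxy)
  have hpos : 0 < ∑ k ∈ Finset.range N, ∑ j ∈ Finset.range N, t k j :=
    Finset.sum_pos' (fun k _ => Finset.sum_nonneg fun j _ => ht0 k j)
      ⟨1, Finset.mem_range.2 (by omega), Finset.sum_pos' (fun j _ => ht0 1 j)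
        ⟨0, Finset.mem_range.2 (by omega), ht1⟩⟩
  have hsum : ∑ k ∈ Finset.range N, ∑ j ∈ Finset.range N, t k j =
      2 * ((∑ k ∈ Finset.range N, a k * y ^ k) * (∑ k ∈ Finset.range N, b k * x ^ k) -
        (∑ k ∈ Finset.range N, a k * x ^ k) * (∑ k ∈ Finset.range N, b k * y ^ k)) := by
    have key : ∀ k j, t k j =
        ((a k * y ^ k) * (b j * x ^ j) - (a k * x ^ k) * (b j * y ^ j)) +
        ((b k * x ^ k) * (a j * y ^ j) - (b k * y ^ k) * (a j * x ^ j)) := by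
      intro k j
      simp only [ht]
      ring
    simp only [key, Finset.sum_add_distrib, Finset.sum_sub_distrib, ← Finset.sum_mul_sum]
    ring
  linarith

/-- The recurrence `(k + 1) * C(m + k + 1, k + 1) = (m + k + 1) * C(m + k, k)`. -/
theorem choose_add_succ_mul_cast (m k : ℕ) :
    ((m + (k + 1)).choose (k + 1) : ℝ) * (k + 1) = (m + k + 1) * ((m + k).choose k : ℝ) := by
  exact_mod_cast (Nat.add_one_mul_choose_eq (m + k) k).symm

/-- Log-concavity of `k ↦ C(m + k, k)`, in cross-multiplied form. -/
theorem choose_add_mul_choose_add_succ_le (m : ℕ) {i l : ℕ} (h : i ≤ l) :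
    ((m + i).choose i : ℝ) * ((m + (l + 1)).choose (l + 1) : ℝ) ≤
      ((m + l).choose l : ℝ) * ((m + (i + 1)).choose (i + 1) : ℝ) := by
  have hi : ((m + (i + 1)).choose (i + 1) : ℝ) = (m + i + 1) / (i + 1) * (m + i).choose i := by
    rw [div_mul_eq_mul_div, eq_div_iff (by positivity), choose_add_succ_mul_cast]
  have hl : ((m + (l + 1)).choose (l + 1) : ℝ) = (m + l + 1) / (l + 1) * (m + l).choose l := by
    rw [div_mul_eq_mul_div, eq_div_iff (by positivity), choose_add_succ_mul_cast]
  have hil : (i : ℝ) ≤ l := by exact_mod_cast h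
  have hr : ((m : ℝ) + l + 1) / (l + 1) ≤ (m + i + 1) / (i + 1) := by
    rw [div_le_div_iff₀ (by positivity) (by positivity)]
    nlinarith [mul_le_mul_of_nonneg_left hil (Nat.cast_nonneg (α := ℝ) m)]
  rw [hi, hl]
  calc ((m + i).choose i : ℝ) * ((m + l + 1) / (l + 1) * (m + l).choose l)
      = (m + l + 1) / (l + 1) * (((m + i).choose i : ℝ) * (m + l).choose l) := by ring
    _ ≤ (m + i + 1) / (i + 1) * (((m + i).choose i : ℝ) * (m + l).choose l) := by gcongr
    _ = _ := by ring

/-- The map `x ↦ x·(1 − C_B·x^B/∑_{k=0}^{B} C_k·x^k)` (throughput as a function of the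
nonempty-source-buffer probability) is strictly increasing on `(0, ∞)`. -/
theorem stmt8 (n B : ℕ) (hn : 3 ≤ n) (hB : 1 ≤ B) :
    StrictMonoOn
      (fun x : ℝ => x * (1 - ((n - 3 + B).choose B : ℝ) * x ^ B /
        (∑ k ∈ Finset.range (B + 1), ((n - 3 + k).choose k : ℝ) * x ^ k)))
      (Set.Ioi (0 : ℝ)) := by
  generalize n - 3 = m
  set b : ℕ → ℝ := fun k => ((m + k).choose k : ℝ) with hb
  set a : ℕ → ℝ := fun k => Nat.casesOn k 0 b with ha
  have hb0 : ∀ k, 0 < b k := fun k => by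
    simp only [hb]
    exact_mod_cast Nat.choose_pos (Nat.le_add_left k m)
  have hS : ∀ x : ℝ, 0 < x → 0 < ∑ k ∈ Finset.range (B + 1), b k * x ^ k := fun x hx =>
    Finset.sum_pos (fun k _ => mul_pos (hb0 k) (pow_pos hx k)) ⟨0, by simp⟩
  have hab : ∀ j k, j ≤ k → a j * b k ≤ a k * b j := by
    rintro (_ | i) (_ | l) h
    · simp [ha]
    · simpa [ha] using (mul_pos (hb0 l) (hb0 0)).le
    · omega
    · exact choose_add_mul_choose_add_succ_le m (by omega)
  have hab' : a 0 * b 1 < a 1 * b 0 := by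
    simpa [ha] using mul_pos (hb0 0) (hb0 0)
  have hf : ∀ x : ℝ, 0 < x →
      x * (1 - b B * x ^ B / ∑ k ∈ Finset.range (B + 1), b k * x ^ k) =
        (∑ k ∈ Finset.range (B + 1), a k * x ^ k) /
          ∑ k ∈ Finset.range (B + 1), b k * x ^ k := by
    intro x hx
    have hA : ∑ k ∈ Finset.range (B + 1), a k * x ^ k =
        x * ∑ k ∈ Finset.range B, b k * x ^ k := by
      rw [Finset.sum_range_succ', Finset.mul_sum]
      have ha0 : a 0 = 0 := rfl
      have ha1 : ∀ k, a (k + 1) = b k := fun _ => rfl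
      simp only [ha0, ha1, zero_mul, add_zero]
      exact Finset.sum_congr rfl fun k _ => by ring
    have hne := (hS x hx).ne'
    rw [hA, one_sub_div hne, mul_div_assoc, Finset.sum_range_succ, add_sub_cancel_right]
  intro x hx y hy hxy
  change x * (1 - b B * x ^ B / ∑ k ∈ Finset.range (B + 1), b k * x ^ k) <
    y * (1 - b B * y ^ B / ∑ k ∈ Finset.range (B + 1), b k * y ^ k)
  rw [hf x hx, hf y hy, div_lt_div_iff₀ (hS x hx) (hS y hy)]
  exact sum_mul_pow_mul_sum_lt_of_ratio_mono a b (by omega) hab hab' (le_of_lt hx) hxy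
end

section
/- Let m ≥ 1 and B ≥ 1 be integers and write a_k = C(m+k, k) for the binomial coefficient. Then for all integers i, j with 0 < j < i ≤ B, one has a_{B−j}·a_{B−i+j} > a_B·a_{B−i}. -/
theorem succ_mul_choose_add_succ (m k : ℕ) :
    (k + 1) * (m + (k + 1)).choose (k + 1) = (m + k + 1) * (m + k).choose k := by
  rw [Nat.add_one_mul_choose_eq, mul_comm, ← add_assoc]

theorem choose_add_succ_mul_lt {m p q : ℕ} (hm : 1 ≤ m) (hpq : p < q) :
    (m + (q + 1)).choose (q + 1) * (m + p).choose p
      < (m + q).choose q * (m + (p + 1)).choose (p + 1) := by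
  have hp := succ_mul_choose_add_succ m p
  have hq := succ_mul_choose_add_succ m q
  have hpos : 0 < (m + q).choose q * (m + p).choose p :=
    Nat.mul_pos (Nat.choose_pos (by lia)) (Nat.choose_pos (by lia))
  have hlin : (m + q + 1) * (p + 1) < (m + p + 1) * (q + 1) := by nlinarith
  refine lt_of_mul_lt_mul_left (a := (p + 1) * (q + 1)) ?_ (Nat.zero_le _)
  calc (p + 1) * (q + 1) * ((m + (q + 1)).choose (q + 1) * (m + p).choose p)
      = (m + q + 1) * (p + 1) * ((m + q).choose q * (m + p).choose p) := by
        linear_combination (p + 1) * (m + p).choose p * hq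
    _ < (m + p + 1) * (q + 1) * ((m + q).choose q * (m + p).choose p) :=
        Nat.mul_lt_mul_of_pos_right hlin hpos
    _ = (p + 1) * (q + 1) * ((m + q).choose q * (m + (p + 1)).choose (p + 1)) := by
        linear_combination -((q + 1) * (m + q).choose q * hp)

/-- A sequence with strictly decreasing consecutive ratios satisfies
`a (c + d + j) * a c < a (c + d) * a (c + j)` for positive `d` and `j`. -/
theorem mul_lt_mul_of_succ_mul_lt {a : ℕ → ℕ}
    (hstep : ∀ p q, p < q → a (q + 1) * a p < a q * a (p + 1))
    (c : ℕ) {d j : ℕ} (hd : 0 < d) (hj : 0 < j) :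
    a (c + d + j) * a c < a (c + d) * a (c + j) := by
  induction j, hj using Nat.le_induction with
  | base => exact hstep c (c + d) (by lia)
  | succ j _ ih =>
    have h := hstep (c + j) (c + d + j) (by lia)
    refine lt_of_mul_lt_mul_left (a := a (c + j) * a (c + d + j)) ?_ (Nat.zero_le _)
    calc a (c + j) * a (c + d + j) * (a (c + d + (j + 1)) * a c)
        = a (c + d + j + 1) * a (c + j) * (a (c + d + j) * a c) := by
          rw [← add_assoc]; ring
      _ < a (c + d + j) * a (c + j + 1) * (a (c + d) * a (c + j)) :=
          Nat.mul_lt_mul'' h ih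
      _ = a (c + j) * a (c + d + j) * (a (c + d) * a (c + (j + 1))) := by
          rw [← add_assoc]; ring

/-- Strict log-concavity-type inequality for `a_k = C(m+k, k)`:
`a_{B−j}·a_{B−i+j} > a_B·a_{B−i}` whenever `0 < j < i ≤ B`. -/
theorem stmt9 (m B : ℕ) (hm : 1 ≤ m) (hB : 1 ≤ B) :
    ∀ i j : ℕ, 0 < j → j < i → i ≤ B →
      (m + (B - j)).choose (B - j) * (m + (B - i + j)).choose (B - i + j)
        > (m + B).choose B * (m + (B - i)).choose (B - i) := by
  intro i j hj hji hiB
  have h := mul_lt_mul_of_succ_mul_lt (a := fun k => (m + k).choose k)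
    (fun p q hpq => choose_add_succ_mul_lt hm hpq)
    (B - i) (d := i - j) (by lia) hj
  rwa [show B - i + (i - j) + j = B by lia, show B - i + (i - j) = B - j by lia] at h
end

section
/- Let λ, μ ∈ (0,1) with λ ≠ μ and set τ = λ(1−μ)/(μ(1−λ)). Then the sequence B ↦ (μ−λ)/(μ − λ·τ^B), defined for integers B ≥ 1, is strictly decreasing: (μ−λ)/(μ − λ·τ^{B+1}) < (μ−λ)/(μ − λ·τ^{B}) for every B ≥ 1. -/
/-- Corollary 3 (source-buffer part): the empty-source-buffer probability
`π_s(0) = (μ−λ)/(μ − λ·τ^B)` is strictly decreasing in the source buffer size `B`. -/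
theorem stmt10 (lam mu : ℝ) (hlam : lam ∈ Set.Ioo (0 : ℝ) 1)
    (hmu : mu ∈ Set.Ioo (0 : ℝ) 1) (hne : lam ≠ mu)
    (tau : ℝ) (htau : tau = lam * (1 - mu) / (mu * (1 - lam))) :
    ∀ B : ℕ, 1 ≤ B →
      (mu - lam) / (mu - lam * tau ^ (B + 1)) < (mu - lam) / (mu - lam * tau ^ B) := by
  obtain ⟨hl0, hl1⟩ := hlam
  obtain ⟨hm0, hm1⟩ := hmu
  intro B _
  have hden : 0 < mu * (1 - lam) := mul_pos hm0 (sub_pos.2 hl1)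
  have htau0 : 0 < tau := by
    rw [htau]
    exact div_pos (mul_pos hl0 (sub_pos.2 hm1)) hden
  have hpow : 0 < lam * tau ^ B := by positivity
  rcases hne.lt_or_gt with h | h
  · have htau1 : tau < 1 := by
      rw [htau, div_lt_one hden]
      linarith
    have hle : lam * tau ^ B ≤ lam := mul_le_of_le_one_right hl0.le (pow_le_one₀ htau0.le htau1.le)
    have hlt : lam * tau ^ (B + 1) < lam * tau ^ B := by
      rw [pow_succ, ← mul_assoc]
      exact mul_lt_of_lt_one_right hpow htau1
    exact div_lt_div_of_pos_left (by linarith) (by linarith) (by linarith)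
  · have htau1 : 1 < tau := by
      rw [htau, one_lt_div hden]
      linarith
    have hle : lam ≤ lam * tau ^ B := le_mul_of_one_le_right hl0.le (one_le_pow₀ htau1.le)
    have hlt : lam * tau ^ B < lam * tau ^ (B + 1) := by
      rw [pow_succ, ← mul_assoc]
      exact lt_mul_of_one_lt_right hpow htau1
    rw [← neg_div_neg_eq, ← neg_div_neg_eq (mu - lam) (mu - lam * tau ^ B)]
    exact div_lt_div_of_pos_left (by linarith) (by linarith) (by linarith)
end

section
/- Let n ≥ 3 be an integer, let x ∈ (0,1] be real, and write C_k = C(n−3+k, k). Then the sequence B ↦ C_B·x^B / ∑_{k=0}^{B} C_k·x^k, defined for integers B ≥ 0, is strictly decreasing: C_{B+1}·x^{B+1}/∑_{k=0}^{B+1} C_k x^k < C_B·x^B/∑_{k=0}^{B} C_k x^k for every B ≥ 0. -/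
/-- The sequence `k ↦ (m + k).choose k` is log-concave. -/
theorem choose_add_succ_mul_choose_le (m : ℕ) {k B : ℕ} (h : k ≤ B) :
    (m + (B + 1)).choose (B + 1) * (m + k).choose k
      ≤ (m + B).choose B * (m + (k + 1)).choose (k + 1) := by
  have hB : (m + B + 1) * (m + B).choose B = (m + (B + 1)).choose (B + 1) * (B + 1) :=
    Nat.add_one_mul_choose_eq (m + B) B
  have hk : (m + k + 1) * (m + k).choose k = (m + (k + 1)).choose (k + 1) * (k + 1) :=
    Nat.add_one_mul_choose_eq (m + k) k
  have hratio : (m + B + 1) * (k + 1) ≤ (m + k + 1) * (B + 1) := by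
    nlinarith [Nat.mul_le_mul_left m h]
  refine Nat.le_of_mul_le_mul_right (c := (B + 1) * (k + 1)) ?_ (by positivity)
  calc (m + (B + 1)).choose (B + 1) * (m + k).choose k * ((B + 1) * (k + 1))
      = (m + (B + 1)).choose (B + 1) * (B + 1) * ((m + k).choose k * (k + 1)) := by ring
    _ = (m + B).choose B * (m + k).choose k * ((m + B + 1) * (k + 1)) := by rw [← hB]; ring
    _ ≤ (m + B).choose B * (m + k).choose k * ((m + k + 1) * (B + 1)) :=
        Nat.mul_le_mul_left _ hratio
    _ = (m + B).choose B * ((m + k + 1) * (m + k).choose k) * (B + 1) := by ring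
    _ = (m + B).choose B * (m + (k + 1)).choose (k + 1) * ((B + 1) * (k + 1)) := by
        rw [hk]; ring

/-- For a positive log-concave sequence, the last term of a partial sum, as a fraction of that sum,
is strictly decreasing. -/
theorem div_sum_range_succ_lt (a : ℕ → ℝ) (hpos : ∀ k, 0 < a k) (B : ℕ)
    (hlog : ∀ k ≤ B, a (B + 1) * a k ≤ a B * a (k + 1)) :
    a (B + 1) / ∑ k ∈ Finset.range (B + 2), a k < a B / ∑ k ∈ Finset.range (B + 1), a k := by
  have hsum (N : ℕ) : 0 < ∑ k ∈ Finset.range (N + 1), a k :=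
    Finset.sum_pos (fun k _ => hpos k) Finset.nonempty_range_add_one
  rw [div_lt_div_iff₀ (hsum (B + 1)) (hsum B), Finset.sum_range_succ' a (B + 1), mul_add,
    Finset.mul_sum, Finset.mul_sum]
  refine lt_add_of_le_of_pos (Finset.sum_le_sum fun k hk => hlog k ?_) (mul_pos (hpos B) (hpos 0))
  exact Finset.mem_range_succ_iff.mp hk

/-- Corollary 3 (relay-buffer part): the relay-buffer overflow probability
`π_r(B) = C_B·x^B/∑_{k=0}^{B} C_k·x^k` is strictly decreasing in the relay buffer size `B`. -/
theorem stmt11 (n : ℕ) (hn : 3 ≤ n) (x : ℝ) (hx0 : 0 < x) (hx1 : x ≤ 1) :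
    ∀ B : ℕ,
      ((n - 3 + (B + 1)).choose (B + 1) : ℝ) * x ^ (B + 1) /
          (∑ k ∈ Finset.range (B + 2), ((n - 3 + k).choose k : ℝ) * x ^ k)
        < ((n - 3 + B).choose B : ℝ) * x ^ B /
          (∑ k ∈ Finset.range (B + 1), ((n - 3 + k).choose k : ℝ) * x ^ k) := by
  intro B
  refine div_sum_range_succ_lt (fun k => ((n - 3 + k).choose k : ℝ) * x ^ k) (fun k => ?_) B
    fun k hk => ?_
  · have := Nat.choose_pos (Nat.le_add_left k (n - 3))
    positivity
  · have h : ((n - 3 + (B + 1)).choose (B + 1) : ℝ) * (n - 3 + k).choose k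
        ≤ (n - 3 + B).choose B * (n - 3 + (k + 1)).choose (k + 1) := by
      exact_mod_cast choose_add_succ_mul_choose_le (n - 3) hk
    calc _ = ((n - 3 + (B + 1)).choose (B + 1) : ℝ) * (n - 3 + k).choose k * x ^ (B + k + 1) := by
          ring
      _ ≤ (n - 3 + B).choose B * (n - 3 + (k + 1)).choose (k + 1) * x ^ (B + k + 1) := by gcongr
      _ = _ := by ring
end

section
/- Let n ≥ 2 be an integer and let p ∈ (0,1] be real. Then ∑_{k=0}^{n−2} C(n−2, k)·p^{k+1}·(1−p)^{n−2−k}/(k+2) = 1/(n·p) − (1−p)/((n−1)·p) + ((1−p)/((n−1)·p) − (1−p)/(n·p))·(1−p)^{n−1}. -/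
/-- The binomial sum without its `k = 0` term. -/
lemma sum_choose_succ_mul_pow {R : Type*} [CommRing R] (x y : R) (m : ℕ) :
    ∑ k ∈ Finset.range (m + 1), ((m + 1).choose (k + 1) : R) * x ^ (k + 1) * y ^ (m - k)
      = (x + y) ^ (m + 1) - y ^ (m + 1) := by
  rw [add_pow, Finset.sum_range_succ' _ (m + 1)]
  simp only [pow_zero, Nat.sub_zero, one_mul, Nat.choose_zero_right, Nat.cast_one, mul_one,
    add_sub_cancel_right, Nat.add_sub_add_right]
  exact Finset.sum_congr rfl fun k _ => by ring

/-- The binomial sum without its `k = 0` and `k = 1` terms. -/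
lemma sum_choose_add_two_mul_pow {R : Type*} [CommRing R] (x y : R) (m : ℕ) :
    ∑ k ∈ Finset.range (m + 1), ((m + 2).choose (k + 2) : R) * x ^ (k + 2) * y ^ (m - k)
      = (x + y) ^ (m + 2) - y ^ (m + 2) - (m + 2) * x * y ^ (m + 1) := by
  have h := sum_choose_succ_mul_pow x y (m + 1)
  rw [Finset.sum_range_succ'] at h
  simp only [Nat.add_sub_add_right, Nat.sub_zero, zero_add, Nat.choose_one_right,
    pow_one] at h
  push_cast at h
  linear_combination h

lemma choose_div_add_two (m k : ℕ) :
    (m.choose k : ℝ) / ((k : ℝ) + 2)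
      = (((m : ℝ) + 2) * (m + 1).choose (k + 1) - (m + 2).choose (k + 2))
        / (((m : ℝ) + 1) * ((m : ℝ) + 2)) := by
  have h1 : ((m : ℝ) + 1) * m.choose k = (m + 1).choose (k + 1) * ((k : ℝ) + 1) := by
    exact_mod_cast Nat.add_one_mul_choose_eq m k
  have h2 : ((m : ℝ) + 2) * (m + 1).choose (k + 1) = (m + 2).choose (k + 2) * ((k : ℝ) + 2) := by
    exact_mod_cast Nat.add_one_mul_choose_eq (m + 1) (k + 1)
  rw [div_eq_div_iff (by positivity) (by positivity)]
  linear_combination ((m : ℝ) + 2) * h1 - h2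


/-- Closed form (24) for `p_sd` in the LS-MAC cell-partitioned MANET, with `p = 1/m²`:
`∑_{k=0}^{n−2} C(n−2,k)·p^{k+1}·(1−p)^{n−2−k}/(k+2)
  = 1/(n·p) − (1−p)/((n−1)·p) + ((1−p)/((n−1)·p) − (1−p)/(n·p))·(1−p)^{n−1}`. -/
theorem stmt18 (n : ℕ) (hn : 2 ≤ n) (p : ℝ) (hp0 : 0 < p) (hp1 : p ≤ 1) :
    ∑ k ∈ Finset.range (n - 1),
        ((n - 2).choose k : ℝ) * p ^ (k + 1) * (1 - p) ^ (n - 2 - k) / ((k : ℝ) + 2)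
      = 1 / ((n : ℝ) * p) - (1 - p) / (((n : ℝ) - 1) * p)
        + ((1 - p) / (((n : ℝ) - 1) * p) - (1 - p) / ((n : ℝ) * p)) * (1 - p) ^ (n - 1) := by
  obtain ⟨m, rfl⟩ : ∃ m, n = m + 2 := ⟨n - 2, by omega⟩
  have hp : p ≠ 0 := hp0.ne'
  have hm1 : (m : ℝ) + 1 ≠ 0 := by positivity
  have hm2 : (m : ℝ) + 2 ≠ 0 := by positivity
  have hsub : m + 2 - 1 = m + 1 := by omega
  have hcast : ((m + 2 : ℕ) : ℝ) - 1 = m + 1 := by push_cast; ring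
  have key : ∑ k ∈ Finset.range (m + 1),
        (m.choose k : ℝ) * p ^ (k + 1) * (1 - p) ^ (m - k) / ((k : ℝ) + 2)
      = (((m : ℝ) + 2) * p * ((p + (1 - p)) ^ (m + 1) - (1 - p) ^ (m + 1))
          - ((p + (1 - p)) ^ (m + 2) - (1 - p) ^ (m + 2) - (m + 2) * p * (1 - p) ^ (m + 1)))
        / (((m : ℝ) + 1) * ((m : ℝ) + 2) * p) := by
    rw [← sum_choose_succ_mul_pow, ← sum_choose_add_two_mul_pow, Finset.mul_sum,
      ← Finset.sum_sub_distrib, Finset.sum_div]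
    refine Finset.sum_congr rfl fun k _ => ?_
    rw [mul_assoc, mul_div_right_comm, choose_div_add_two]
    field_simp
    ring
  rw [hcast, hsub, Nat.add_sub_cancel, key, add_sub_cancel]
  push_cast
  field_simp
  ring
end

section
/- Let n ≥ 2 be an integer and let p ∈ (0,1] be real. Then ∑_{k=1}^{n−2} C(n−2, k)·p^k·(1−p)^{n−1−k}/(k+1) = (1−p)/((n−1)·p) − (1/((n−1)·p))·(1−p)^n − (1−p)^{n−1}. -/
/-- Integrated form of the binomial theorem. -/
theorem mul_sum_choose_div_succ {K : Type*} [Field K] [CharZero K] (x y : K) (N : ℕ) :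
    ((N : K) + 1) * x *
        ∑ k ∈ Finset.range (N + 1), (N.choose k : K) * x ^ k * y ^ (N - k) / ((k : K) + 1)
      = (x + y) ^ (N + 1) - y ^ (N + 1) := by
  rw [add_pow, Finset.mul_sum, Finset.sum_range_succ' _ (N + 1)]
  simp only [pow_zero, Nat.sub_zero, one_mul, Nat.choose_zero_right, Nat.cast_one, mul_one,
    add_sub_cancel_right, Nat.add_sub_add_right]
  refine Finset.sum_congr rfl fun k _ => ?_
  have hk : (k : K) + 1 ≠ 0 := Nat.cast_add_one_ne_zero k
  have h : ((N : K) + 1) * N.choose k = (N + 1).choose (k + 1) * ((k : K) + 1) := by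
    exact_mod_cast Nat.add_one_mul_choose_eq N k
  field_simp
  linear_combination x ^ (k + 1) * y ^ (N - k) * h

/-- Closed form (25) for `2·p_sr = 2·p_rd` in the LS-MAC cell-partitioned MANET, with `p = 1/m²`:
`∑_{k=1}^{n−2} C(n−2,k)·p^k·(1−p)^{n−1−k}/(k+1)
  = (1−p)/((n−1)·p) − (1/((n−1)·p))·(1−p)^n − (1−p)^{n−1}`. -/
theorem stmt19 (n : ℕ) (hn : 2 ≤ n) (p : ℝ) (hp0 : 0 < p) (hp1 : p ≤ 1) :
    ∑ k ∈ Finset.Icc 1 (n - 2),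
        ((n - 2).choose k : ℝ) * p ^ k * (1 - p) ^ (n - 1 - k) / ((k : ℝ) + 1)
      = (1 - p) / (((n : ℝ) - 1) * p) - (1 / (((n : ℝ) - 1) * p)) * (1 - p) ^ n
        - (1 - p) ^ (n - 1) := by
  obtain ⟨N, rfl⟩ := Nat.exists_eq_add_of_le' hn
  have hN : (N : ℝ) + 1 ≠ 0 := Nat.cast_add_one_ne_zero N
  have hcast : ((N + 2 : ℕ) : ℝ) - 1 = N + 1 := by push_cast; ring
  have hsum : ∑ k ∈ Finset.range (N + 1),
        (N.choose k : ℝ) * p ^ k * (1 - p) ^ (N + 1 - k) / ((k : ℝ) + 1)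
      = (1 - p) * ∑ k ∈ Finset.range (N + 1),
        (N.choose k : ℝ) * p ^ k * (1 - p) ^ (N - k) / ((k : ℝ) + 1) := by
    rw [Finset.mul_sum]
    refine Finset.sum_congr rfl fun k hk => ?_
    rw [Nat.succ_sub (Finset.mem_range_succ_iff.mp hk), pow_succ]
    ring
  have hint := mul_sum_choose_div_succ p (1 - p) N
  rw [add_sub_cancel, one_pow] at hint
  rw [Finset.range_eq_Ico, Finset.sum_eq_sum_Ico_succ_bot N.succ_pos, ← Finset.range_eq_Ico]
    at hsum
  simp only [Nat.choose_zero_right, Nat.cast_one, pow_zero, mul_one, one_mul, Nat.sub_zero,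
    Nat.cast_zero, zero_add, div_one] at hsum
  rw [Nat.add_sub_cancel, show N + 2 - 1 = N + 1 from rfl, hcast,
    show Finset.Icc 1 N = Finset.Ico 1 (N + 1) from rfl, eq_sub_of_add_eq' hsum]
  field_simp
  linear_combination (1 - p) * hint
end
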